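/- Let (λ_n)_{n∈ℕ} be a nondecreasing sequence of positive real numbers tending to +∞, let c > 0 be a real number such that Σ_n e^{−c·λ_n} converges, and for complex s with Re s = c define K(s) = Σ_n e^{−λ_n s}. Let μ > 0 be a real number with μ ≠ λ_n for every n, and let N(μ) = #{n : λ_n < μ}. Then the principal-value Bromwich integral recovers the counting function: lim_{T→∞} (1/(2π)) ∫_{−T}^{T} K(c + i y) · e^{μ(c + i y)} / (c + i y) dy = N(μ). -/

import Mathlib

open Complex MeasureTheory Filter Topology Set

/-- A point of the vertical line `Re s = c` with `c > 0` is nonzero. -/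
lemma verticalLine_ne_zero {c : ℝ} (hc : 0 < c) (y : ℝ) : (c : ℂ) + y * I ≠ 0 := by
  intro h
  have := congrArg re h
  simp at this
  exact hc.ne' this

lemma le_norm_verticalLine (c y : ℝ) : c ≤ ‖(c : ℂ) + y * I‖ := by
  simpa using re_le_norm ((c : ℂ) + y * I)

lemma norm_exp_mul_verticalLine (a c y : ℝ) :
    ‖exp ((a : ℂ) * ((c : ℂ) + y * I))‖ = Real.exp (a * c) := by
  simp [norm_exp]

/-- `1 / s ^ 2` is integrable along the vertical line `Re s = c`. -/
lemma integrable_inv_sq_verticalLine {c : ℝ} (hc : 0 < c) :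
    Integrable fun y : ℝ => (((c : ℂ) + y * I) ^ 2)⁻¹ := by
  have h := (integrable_inv_one_add_sq.comp_div hc.ne').const_mul (c ^ 2)⁻¹
  refine h.mono' ?_ (Eventually.of_forall fun y => le_of_eq ?_)
  · exact (Continuous.inv₀ (by fun_prop)
      fun y => pow_ne_zero 2 (verticalLine_ne_zero hc y)).aestronglyMeasurable
  · rw [norm_inv, norm_pow, ← normSq_eq_norm_sq, normSq_add_mul_I]
    field_simp

lemma continuous_exp_mul_div_verticalLine {c : ℝ} (hc : 0 < c) (a : ℝ) :
    Continuous fun y : ℝ => exp ((a : ℂ) * ((c : ℂ) + y * I)) / ((c : ℂ) + y * I) :=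
  Continuous.div (by fun_prop) (by fun_prop) (verticalLine_ne_zero hc)

/-- `e ^ (a s) / s ^ 2` is integrable along the vertical line `Re s = c`. -/
lemma integrable_exp_mul_inv_sq_verticalLine {c : ℝ} (hc : 0 < c) (a : ℝ) :
    Integrable fun y : ℝ =>
      exp ((a : ℂ) * ((c : ℂ) + y * I)) * (((c : ℂ) + y * I) ^ 2)⁻¹ :=
  (integrable_inv_sq_verticalLine hc).bdd_mul (c := Real.exp (a * c))
    (Continuous.aestronglyMeasurable (by fun_prop))
    (Eventually.of_forall fun y => (norm_exp_mul_verticalLine a c y).le)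

/-- The Mellin transform of `log` restricted to `(0, 1]` is `-1 / s ^ 2`. -/
lemma hasMellin_log_Ioc {s : ℂ} (hs : 0 < s.re) :
    HasMellin (fun t : ℝ => Real.log t • indicator (Ioc 0 1) (fun _ => (1 : ℂ)) t) s
      (-(s ^ 2)⁻¹) := by
  have hs0 : s ≠ 0 := by
    rintro rfl
    simp at hs
  obtain ⟨hconv, hderiv⟩ := mellin_hasDerivAt_of_isBigO_rpow (a := s.re + 1) (b := 0) (s := s)
    (f := indicator (Ioc 0 1) (fun _ => (1 : ℂ)))
    (((locallyIntegrable_const (1 : ℂ)).indicator measurableSet_Ioc).locallyIntegrableOn _)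
    (by
      refine Asymptotics.IsBigO.of_bound 0 ?_
      filter_upwards [eventually_gt_atTop 1] with t ht
      simp [indicator, ht.not_ge])
    (by linarith)
    (by
      refine Asymptotics.IsBigO.of_bound 1 (Eventually.of_forall fun t => ?_)
      by_cases h : t ∈ Ioc (0 : ℝ) 1 <;> simp [h])
    hs
  refine ⟨hconv, hderiv.unique ?_⟩
  refine (hasDerivAt_inv hs0).congr_of_eventuallyEq ?_
  filter_upwards [(isOpen_lt continuous_const continuous_re).mem_nhds hs] with z hz
  rw [(hasMellin_one_Ioc hz).2, one_div]

/-- The inverse Laplace transform of `1 / s ^ 2` at `a ≠ 0` is `max a 0`. -/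
lemma integral_exp_mul_inv_sq_verticalLine {c : ℝ} (hc : 0 < c) {a : ℝ} (ha : a ≠ 0) :
    ∫ y : ℝ, exp ((a : ℂ) * ((c : ℂ) + y * I)) * (((c : ℂ) + y * I) ^ 2)⁻¹ =
      2 * Real.pi * (if 0 < a then (a : ℂ) else 0) := by
  set f : ℝ → ℂ := fun t => Real.log t • indicator (Ioc 0 1) (fun _ => (1 : ℂ)) t with hf
  have hmellin : ∀ y : ℝ, mellin f ((c : ℂ) + y * I) = -(((c : ℂ) + y * I) ^ 2)⁻¹ :=
    fun y => (hasMellin_log_Ioc (by simpa using hc)).2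
  have hvert : VerticalIntegrable (mellin f) c := by
    simp only [VerticalIntegrable, hmellin]
    exact (integrable_inv_sq_verticalLine hc).neg
  have hcont : ContinuousAt f (Real.exp (-a)) := by
    rcases ha.lt_or_gt with h | h
    · have : f =ᶠ[𝓝 (Real.exp (-a))] fun _ => 0 := by
        filter_upwards [eventually_gt_nhds (Real.one_lt_exp_iff.2 (neg_pos.2 h))] with t ht
        simp [hf, indicator, ht.not_ge]
      exact continuousAt_const.congr this.symm
    · have : f =ᶠ[𝓝 (Real.exp (-a))] fun t => (Real.log t : ℂ) := by
        filter_upwards [eventually_lt_nhds (Real.exp_lt_one_iff.2 (neg_neg_iff_pos.2 h)),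
          eventually_gt_nhds (Real.exp_pos (-a))] with t ht ht0
        simp [hf, indicator, ht.le, ht0]
      exact ContinuousAt.congr
        (continuous_ofReal.continuousAt.comp (Real.continuousAt_log (Real.exp_pos _).ne'))
        this.symm
  have hinv := mellinInv_mellin_eq c f (Real.exp_pos (-a))
    (hasMellin_log_Ioc (by simpa using hc)).1 hvert hcont
  have hpow : ∀ y : ℝ, ((Real.exp (-a) : ℝ) : ℂ) ^ (-((c : ℂ) + y * I)) =
      exp ((a : ℂ) * ((c : ℂ) + y * I)) := by
    intro y
    rw [cpow_def_of_ne_zero (by exact_mod_cast (Real.exp_pos _).ne'),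
      ← ofReal_log (Real.exp_pos _).le, Real.log_exp]
    push_cast
    ring_nf
  have hval : f (Real.exp (-a)) = -(if 0 < a then (a : ℂ) else 0) := by
    rcases ha.lt_or_gt with h | h
    · simp [hf, indicator, h, h.not_gt]
    · simp [hf, indicator, h, h.le, Real.exp_pos]
  simp only [mellinInv, hmellin, hpow, hval, smul_eq_mul, mul_neg, integral_neg, smul_neg,
    neg_inj, real_smul] at hinv
  have hpi : (Real.pi : ℂ) ≠ 0 := by exact_mod_cast Real.pi_ne_zero
  rw [← hinv, ← mul_assoc]
  push_cast
  rw [mul_one_div_cancel (mul_ne_zero two_ne_zero hpi), one_mul]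

/-- Integration by parts for the truncated Perron integral. -/
lemma integral_exp_mul_div_verticalLine {c : ℝ} (hc : 0 < c) {a : ℝ} (ha : a ≠ 0) (T : ℝ) :
    ∫ y in (-T)..T, exp ((a : ℂ) * ((c : ℂ) + y * I)) / ((c : ℂ) + y * I) =
      (a : ℂ)⁻¹ * (((c : ℂ) + T * I)⁻¹ * (exp ((a : ℂ) * ((c : ℂ) + T * I)) / I) -
        ((c : ℂ) + (-T : ℝ) * I)⁻¹ * (exp ((a : ℂ) * ((c : ℂ) + (-T : ℝ) * I)) / I) +
        ∫ y in (-T)..T, exp ((a : ℂ) * ((c : ℂ) + y * I)) * (((c : ℂ) + y * I) ^ 2)⁻¹) := by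
  have ha' : (a : ℂ) ≠ 0 := by exact_mod_cast ha
  have hline : ∀ y : ℝ, HasDerivAt (fun y : ℝ => (c : ℂ) + y * I) I y := fun y => by
    simpa using ((hasDerivAt_id y).ofReal_comp.mul_const I).const_add (c : ℂ)
  have hu : ∀ y : ℝ, HasDerivAt (fun y : ℝ => ((c : ℂ) + y * I)⁻¹)
      (-I / ((c : ℂ) + y * I) ^ 2) y :=
    fun y => (hline y).fun_inv (verticalLine_ne_zero hc y)
  have hv : ∀ y : ℝ, HasDerivAt (fun y : ℝ => exp ((a : ℂ) * ((c : ℂ) + y * I)) / I)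
      (a * exp ((a : ℂ) * ((c : ℂ) + y * I))) y := fun y => by
    refine (((hline y).const_mul (a : ℂ)).cexp.div_const I).congr_deriv ?_
    field_simp
  have hparts := intervalIntegral.integral_mul_deriv_eq_deriv_mul (a := -T) (b := T)
    (fun y _ => hu y) (fun y _ => hv y)
    (Continuous.intervalIntegrable (Continuous.div (by fun_prop) (by fun_prop)
      fun y => pow_ne_zero 2 (verticalLine_ne_zero hc y)) _ _)
    (Continuous.intervalIntegrable (by fun_prop) _ _)
  rw [eq_inv_mul_iff_mul_eq₀ ha', ← intervalIntegral.integral_const_mul]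
  rw [sub_eq_add_neg, ← intervalIntegral.integral_neg] at hparts
  refine Eq.trans (intervalIntegral.integral_congr fun y _ => ?_) (hparts.trans
    (congrArg _ (intervalIntegral.integral_congr fun y _ => ?_)))
  · ring
  · field_simp

/-- The truncated Perron integral is bounded by a multiple of `e ^ (a c) / |a|`, uniformly in the
truncation. -/
lemma norm_integral_exp_mul_div_verticalLine_le {c : ℝ} (hc : 0 < c) {a : ℝ} (ha : a ≠ 0)
    (T : ℝ) :
    ‖∫ y in (-T)..T, exp ((a : ℂ) * ((c : ℂ) + y * I)) / ((c : ℂ) + y * I)‖ ≤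
      |a|⁻¹ * Real.exp (a * c) * (2 * c⁻¹ + ∫ y : ℝ, ‖(((c : ℂ) + y * I) ^ 2)⁻¹‖) := by
  have hbdry : ∀ y : ℝ,
      ‖((c : ℂ) + y * I)⁻¹ * (exp ((a : ℂ) * ((c : ℂ) + y * I)) / I)‖ ≤
        c⁻¹ * Real.exp (a * c) := fun y => by
    rw [norm_mul, norm_div, norm_I, div_one, norm_exp_mul_verticalLine, norm_inv]
    gcongr
    exact le_norm_verticalLine c y
  have hint : ‖∫ y in (-T)..T,
      exp ((a : ℂ) * ((c : ℂ) + y * I)) * (((c : ℂ) + y * I) ^ 2)⁻¹‖ ≤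
        Real.exp (a * c) * ∫ y : ℝ, ‖(((c : ℂ) + y * I) ^ 2)⁻¹‖ := by
    refine intervalIntegral.norm_integral_le_integral_norm_uIoc.trans ?_
    rw [← integral_const_mul]
    simp only [norm_mul, norm_exp_mul_verticalLine]
    exact setIntegral_le_integral ((integrable_inv_sq_verticalLine hc).norm.const_mul _)
      (Eventually.of_forall fun y => by positivity)
  rw [integral_exp_mul_div_verticalLine hc ha, norm_mul, norm_inv, norm_real, Real.norm_eq_abs,
    mul_assoc]
  gcongr
  refine (norm_add_le _ _).trans ?_
  have := (norm_sub_le _ _).trans (add_le_add (hbdry T) (hbdry (-T)))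
  linarith

/-- Perron's formula: the inverse Laplace transform of `1 / s` is the Heaviside function. -/
lemma tendsto_integral_exp_mul_div_verticalLine {c : ℝ} (hc : 0 < c) {a : ℝ} (ha : a ≠ 0) :
    Tendsto (fun T : ℝ =>
      (1 / (2 * Real.pi) : ℂ) *
        ∫ y in (-T)..T, exp ((a : ℂ) * ((c : ℂ) + y * I)) / ((c : ℂ) + y * I))
      atTop (𝓝 (if 0 < a then 1 else 0)) := by
  have ha' : (a : ℂ) ≠ 0 := by exact_mod_cast ha
  have hbdry : Tendsto
      (fun y : ℝ => ((c : ℂ) + y * I)⁻¹ * (exp ((a : ℂ) * ((c : ℂ) + y * I)) / I))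
      (cocompact ℝ) (𝓝 0) := by
    have hinv : Tendsto (fun y : ℝ => Real.exp (a * c) * ‖y‖⁻¹) (cocompact ℝ) (𝓝 0) := by
      simpa using (tendsto_inv_atTop_zero.comp
        (tendsto_norm_cocompact_atTop (E := ℝ))).const_mul (Real.exp (a * c))
    refine squeeze_zero_norm' ?_ hinv
    filter_upwards [(tendsto_norm_cocompact_atTop (E := ℝ)).eventually_gt_atTop 0] with y hy
    rw [norm_mul, norm_div, norm_I, div_one, norm_exp_mul_verticalLine, norm_inv, mul_comm]
    gcongr
    simpa using abs_im_le_norm ((c : ℂ) + y * I)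
  have htop := hbdry.mono_left (atTop_le_cocompact (α := ℝ))
  have hbot := (hbdry.mono_left (atBot_le_cocompact (α := ℝ))).comp tendsto_neg_atTop_atBot
  have hint := intervalIntegral_tendsto_integral (integrable_exp_mul_inv_sq_verticalLine hc a)
    tendsto_neg_atTop_atBot tendsto_id
  rw [integral_exp_mul_inv_sq_verticalLine hc ha] at hint
  have h := (((htop.sub hbot).add hint).const_mul (a : ℂ)⁻¹).const_mul (1 / (2 * Real.pi) : ℂ)
  have hpi : (Real.pi : ℂ) ≠ 0 := by exact_mod_cast Real.pi_ne_zero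
  have hval : (1 / (2 * Real.pi) : ℂ) *
      ((a : ℂ)⁻¹ * (0 - 0 + 2 * Real.pi * (if 0 < a then (a : ℂ) else 0))) =
        if 0 < a then 1 else 0 := by
    split_ifs
    · field_simp
      simp
    · simp
  rw [hval] at h
  simpa only [integral_exp_mul_div_verticalLine hc ha] using! h

/-- Interchange of the Dirichlet series with the truncated contour integral. -/
lemma hasSum_integral_exp_mul_div_verticalLine {lam : ℕ → ℝ} {c : ℝ} (hc : 0 < c)
    (hsum : Summable fun n => Real.exp (-c * lam n)) (μ T : ℝ) :
    HasSum (fun n => ∫ y in (-T)..T,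
        exp (((μ - lam n : ℝ) : ℂ) * ((c : ℂ) + y * I)) / ((c : ℂ) + y * I))
      (∫ y in (-T)..T, (∑' n, exp (-(lam n : ℂ) * ((c : ℂ) + y * I))) *
        exp ((μ : ℂ) * ((c : ℂ) + y * I)) / ((c : ℂ) + y * I)) := by
  have hexp : ∀ n, Real.exp ((μ - lam n) * c) = Real.exp (-c * lam n) * Real.exp (μ * c) :=
    fun n => by rw [← Real.exp_add]; ring_nf
  refine intervalIntegral.hasSum_integral_of_dominated_convergence
    (fun n _ => Real.exp ((μ - lam n) * c) / c)
    (fun n => (continuous_exp_mul_div_verticalLine hc _).aestronglyMeasurable)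
    (fun n => Eventually.of_forall fun y _ => ?_) (Eventually.of_forall fun y _ => ?_)
    intervalIntegrable_const (Eventually.of_forall fun y _ => ?_)
  · rw [norm_div, norm_exp_mul_verticalLine]
    gcongr
    exact le_norm_verticalLine c y
  · simp only [hexp]
    exact (hsum.mul_right _).div_const c
  · have hs : Summable fun n => exp (-(lam n : ℂ) * ((c : ℂ) + y * I)) := by
      refine Summable.of_norm (hsum.congr fun n => ?_)
      rw [← ofReal_neg, norm_exp_mul_verticalLine]
      ring_nf
    have hterm : ∀ n, exp (((μ - lam n : ℝ) : ℂ) * ((c : ℂ) + y * I)) =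
        exp (-(lam n : ℂ) * ((c : ℂ) + y * I)) * exp ((μ : ℂ) * ((c : ℂ) + y * I)) := fun n => by
      rw [← exp_add]
      push_cast
      ring_nf
    simp only [hterm]
    exact (hs.hasSum.mul_right _).div_const _

/-- A sequence tending to infinity stays at positive distance from any value it avoids. -/
lemma exists_pos_le_abs_sub {lam : ℕ → ℝ} (htend : Tendsto lam atTop atTop) {μ : ℝ}
    (hμ : ∀ n, μ ≠ lam n) : ∃ δ > 0, ∀ n, δ ≤ |μ - lam n| := by
  have hlim : Tendsto (fun n => |μ - lam n|) cofinite atTop := by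
    rw [Nat.cofinite_eq_atTop]
    exact tendsto_abs_atBot_atTop.comp (tendsto_const_nhds.add_atBot
      (tendsto_neg_atTop_atBot.comp htend))
  obtain ⟨m, hm⟩ := hlim.exists_forall_le
  exact ⟨|μ - lam m|, abs_pos.2 (sub_ne_zero.2 (hμ m)), hm⟩

/-- Perron-type inversion: for a nondecreasing positive real sequence
`lam` tending to `+∞`, `c > 0` with `∑ n, exp (-c * lam n)` summable, and the heat
kernel `K(s) = ∑ n, exp (-lam n * s)` on the line `Re s = c`, the principal-value
Bromwich integral recovers the counting function at any `μ > 0` avoiding all `lam n`: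
`lim_{T→∞} (1/(2π)) ∫_{-T}^{T} K(c+iy) e^{μ(c+iy)} / (c+iy) dy = N(μ)`. -/
theorem bromwich_integral_recovers_counting_function
    (lam : ℕ → ℝ) (hmono : Monotone lam) (hpos : ∀ n, 0 < lam n)
    (htend : Filter.Tendsto lam Filter.atTop Filter.atTop)
    (c : ℝ) (hc : 0 < c)
    (hsum : Summable fun n => Real.exp (-c * lam n))
    (K : ℂ → ℂ)
    (hK : ∀ s : ℂ, s.re = c → K s = ∑' n, Complex.exp (-(lam n : ℂ) * s))
    (μ : ℝ) (hμpos : 0 < μ) (hμ : ∀ n, μ ≠ lam n) :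
    Filter.Tendsto
      (fun T : ℝ =>
        (1 / (2 * Real.pi) : ℂ) *
          ∫ y in (-T)..T,
            K ((c : ℂ) + y * Complex.I) *
              Complex.exp ((μ : ℂ) * ((c : ℂ) + y * Complex.I)) /
              ((c : ℂ) + y * Complex.I))
      Filter.atTop
      (nhds ((Nat.card {n : ℕ | lam n < μ} : ℂ))) := by
  obtain ⟨δ, hδ, hle⟩ := exists_pos_le_abs_sub htend hμ
  have hne : ∀ n, μ - lam n ≠ 0 := fun n => sub_ne_zero.2 (hμ n)
  set C : ℝ := 2 * c⁻¹ + ∫ y : ℝ, ‖(((c : ℂ) + y * I) ^ 2)⁻¹‖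
  have hC : 0 ≤ C := by positivity
  have hlim : Tendsto (fun T : ℝ => ∑' n, (1 / (2 * Real.pi) : ℂ) * ∫ y in (-T)..T,
      exp (((μ - lam n : ℝ) : ℂ) * ((c : ℂ) + y * I)) / ((c : ℂ) + y * I)) atTop
      (𝓝 (∑' n, if 0 < μ - lam n then (1 : ℂ) else 0)) := by
    refine tendsto_tsum_of_dominated_convergence
      (bound := fun n => ‖(1 / (2 * Real.pi) : ℂ)‖ *
        (δ⁻¹ * (Real.exp (-c * lam n) * Real.exp (μ * c)) * C))
      ((((hsum.mul_right _).mul_left _).mul_right _).mul_left _)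
      (fun n => tendsto_integral_exp_mul_div_verticalLine hc (hne n))
      (Eventually.of_forall fun T n => ?_)
    rw [norm_mul]
    gcongr
    refine (norm_integral_exp_mul_div_verticalLine_le hc (hne n) T).trans ?_
    rw [← Real.exp_add, show -c * lam n + μ * c = (μ - lam n) * c by ring]
    gcongr
    exact hle n
  have hfin : {n : ℕ | lam n < μ}.Finite := by
    have := htend.eventually_ge_atTop μ
    rw [← Nat.cofinite_eq_atTop, eventually_cofinite] at this
    simpa using this
  have hcount : (∑' n, if 0 < μ - lam n then (1 : ℂ) else 0) =
      (Nat.card {n : ℕ | lam n < μ} : ℂ) := by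
    rw [tsum_eq_sum (s := hfin.toFinset) (fun n hn => by simpa using hn),
      Finset.sum_congr rfl (g := fun _ => (1 : ℂ)) (fun n hn => by simpa using hn),
      Nat.card_coe_set_eq, ncard_eq_toFinset_card _ hfin]
    simp
  rw [← hcount]
  refine hlim.congr fun T => ?_
  rw [tsum_mul_left, (hasSum_integral_exp_mul_div_verticalLine hc hsum μ T).tsum_eq]
  congr 1
  refine intervalIntegral.integral_congr fun y _ => ?_
  simp only [hK ((c : ℂ) + y * I) (by simp)]
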